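/- Let Ω be a locally compact metrisable space and let {μₙ} and μ be finite signed Radon measures on Ω with Hahn–Jordan decompositions μₙ = μₙ⁺ − μₙ⁻ and μ = μ⁺ − μ⁻. If μₙ → μ vaguely and limsup_{n→∞} ‖μₙ‖ ≤ ‖μ‖, then μₙ⁺ → μ⁺ weakly and μₙ⁻ → μ⁻ weakly. -/

import Mathlib

open MeasureTheory Filter Topology
open scoped ENNReal

/-- Integral of a real-valued function against a finite signed measure, via the
Hahn–Jordan decomposition `μ = μ⁺ - μ⁻`. -/
noncomputable def sInt {Ω : Type*} [MeasurableSpace Ω] (μ : SignedMeasure Ω) (f : Ω → ℝ) : ℝ :=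
  (∫ x, f x ∂μ.toJordanDecomposition.posPart) - ∫ x, f x ∂μ.toJordanDecomposition.negPart

/-- Vague convergence of signed measures: convergence of integrals against all
continuous compactly supported test functions. -/
def VagueTendsto {Ω : Type*} [TopologicalSpace Ω] [MeasurableSpace Ω]
    (μs : ℕ → SignedMeasure Ω) (μ : SignedMeasure Ω) : Prop :=
  ∀ f : Ω → ℝ, Continuous f → HasCompactSupport f →
    Tendsto (fun n => sInt (μs n) f) atTop (𝓝 (sInt μ f))

/-- Weak convergence of signed measures: convergence of integrals against all
bounded continuous test functions. -/
def WeakTendsto {Ω : Type*} [TopologicalSpace Ω] [MeasurableSpace Ω]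
    (μs : ℕ → SignedMeasure Ω) (μ : SignedMeasure Ω) : Prop :=
  ∀ f : Ω → ℝ, Continuous f → (∃ C : ℝ, ∀ x, |f x| ≤ C) →
    Tendsto (fun n => sInt (μs n) f) atTop (𝓝 (sInt μ f))

theorem exists_cutoff_of_mutuallySingular {Ω : Type*} [TopologicalSpace Ω]
    [TopologicalSpace.MetrizableSpace Ω] [LocallyCompactSpace Ω]
    [MeasurableSpace Ω] [BorelSpace Ω] (P N : Measure Ω) [IsFiniteMeasure P] [IsFiniteMeasure N]
    (hPN : P ⟂ₘ N) (hreg : (P + N).InnerRegular) {ε : ℝ} (hε : 0 < ε) :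
    ∃ (K U : Set Ω) (φ : Ω → ℝ), MeasurableSet K ∧ MeasurableSet U ∧ P.real Kᶜ < ε ∧
      N.real U < ε ∧ Continuous φ ∧ HasCompactSupport φ ∧ (∀ x, φ x ∈ Set.Icc 0 1) ∧
      (∀ x ∈ K, φ x = 1) ∧ (∀ x ∉ U, φ x = 0) := by
  obtain ⟨S, hS, hPS, hNS⟩ := hPN
  have hε' : ENNReal.ofReal ε ≠ 0 := by simpa using hε
  obtain ⟨K, hKS, hK, hKε⟩ := hS.compl.exists_isCompact_sdiff_lt (measure_ne_top (P + N) Sᶜ) hε'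
  have hNK : N K < ENNReal.ofReal ε := by
    rw [measure_mono_null hKS hNS]
    exact pos_iff_ne_zero.mpr hε'
  obtain ⟨U, hKU, hU, hUε⟩ := K.exists_isOpen_lt_of_lt _ hNK
  obtain ⟨φ, hφK, hφU, hφc, hφ⟩ := exists_continuous_one_zero_of_isCompact hK
    hU.isClosed_compl (Set.disjoint_compl_right_iff_subset.mpr hKU)
  have hPK : P Kᶜ < ENNReal.ofReal ε := by
    refine lt_of_le_of_lt ?_ hKε
    calc P Kᶜ ≤ P (S ∪ (Sᶜ \ K)) := measure_mono fun x hx => by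
          by_cases h : x ∈ S
          · exact Or.inl h
          · exact Or.inr ⟨h, hx⟩
      _ ≤ P S + P (Sᶜ \ K) := measure_union_le _ _
      _ = P (Sᶜ \ K) := by rw [hPS, zero_add]
      _ ≤ (P + N) (Sᶜ \ K) := by simp
  refine ⟨K, U, φ, hK.measurableSet, hU.measurableSet, ?_, ?_, φ.continuous, hφc, hφ,
    fun x hx => hφK hx, fun x hx => hφU hx⟩
  · exact (ENNReal.lt_ofReal_iff_toReal_lt (measure_ne_top _ _)).mp hPK
  · exact (ENNReal.lt_ofReal_iff_toReal_lt (measure_ne_top _ _)).mp hUε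

theorem Continuous.integrable_of_abs_le {Ω : Type*} [TopologicalSpace Ω]
    [TopologicalSpace.MetrizableSpace Ω] [MeasurableSpace Ω] [BorelSpace Ω] {f : Ω → ℝ}
    (hf : Continuous f) {C : ℝ} (hC : ∀ x, |f x| ≤ C) (P : Measure Ω) [IsFiniteMeasure P] :
    Integrable f P :=
  .of_bound hf.measurable.aestronglyMeasurable C (Eventually.of_forall hC)

/-- If the differences `Ps n - Ns n` converge vaguely to `P - N` with `P` and `N` mutually
singular, then integration of nonnegative bounded functions is asymptotically at least that
against `P`. -/
theorem eventually_integral_sub_lt_of_vague {Ω : Type*} [TopologicalSpace Ω]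
    [TopologicalSpace.MetrizableSpace Ω] [LocallyCompactSpace Ω]
    [MeasurableSpace Ω] [BorelSpace Ω] (Ps Ns : ℕ → Measure Ω) (P N : Measure Ω)
    [∀ n, IsFiniteMeasure (Ps n)] [IsFiniteMeasure P] [IsFiniteMeasure N]
    (hPN : P ⟂ₘ N) (hreg : (P + N).InnerRegular)
    (hvague : ∀ f : Ω → ℝ, Continuous f → HasCompactSupport f →
      Tendsto (fun n => (∫ x, f x ∂Ps n) - ∫ x, f x ∂Ns n) atTop
        (𝓝 ((∫ x, f x ∂P) - ∫ x, f x ∂N)))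
    {g : Ω → ℝ} (hg : Continuous g) (hg0 : ∀ x, 0 ≤ g x) {C : ℝ} (hC : ∀ x, g x ≤ C)
    {ε : ℝ} (hε : 0 < ε) :
    ∀ᶠ n in atTop, (∫ x, g x ∂P) - ε < ∫ x, g x ∂Ps n := by
  obtain ⟨δ, hδ, hδε⟩ : ∃ δ : ℝ, 0 < δ ∧ 2 * (|C| * δ) < ε := by
    refine ⟨ε / (2 * (|C| + 1)), by positivity, ?_⟩
    have hC1 : 0 < |C| + 1 := by positivity
    have : 2 * (|C| * (ε / (2 * (|C| + 1)))) = |C| * ε / (|C| + 1) := by field_simp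
    rw [this, div_lt_iff₀ hC1]
    nlinarith
  obtain ⟨K, U, φ, hK, hU, hPK, hNU, hφ, hφc, hφ01, hφK, hφU⟩ :=
    exists_cutoff_of_mutuallySingular P N hPN hreg hδ
  have hgC : ∀ x, g x ≤ |C| := fun x => (hC x).trans (le_abs_self C)
  have hφg0 : ∀ x, 0 ≤ φ x * g x := fun x => mul_nonneg (hφ01 x).1 (hg0 x)
  have hφgle : ∀ x, φ x * g x ≤ g x := fun x => mul_le_of_le_one_left (hg0 x) (hφ01 x).2
  have hgi : ∀ (Q : Measure Ω) [IsFiniteMeasure Q], Integrable g Q := fun Q _ =>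
    hg.integrable_of_abs_le (fun x => (abs_of_nonneg (hg0 x)).trans_le (hgC x)) Q
  have hφgi : ∀ (Q : Measure Ω) [IsFiniteMeasure Q], Integrable (fun x => φ x * g x) Q := fun Q _ =>
    (hφ.mul hg).integrable_of_abs_le
      (fun x => (abs_of_nonneg (hφg0 x)).trans_le ((hφgle x).trans (hgC x))) Q
  have hP : (∫ x, g x ∂P) - ∫ x, φ x * g x ∂P ≤ |C| * δ := by
    rw [← integral_sub (hgi P) (hφgi P)]
    calc ∫ x, (g x - φ x * g x) ∂P ≤ ∫ x, Kᶜ.indicator (fun _ => |C|) x ∂P := by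
          refine integral_mono ((hgi P).sub (hφgi P))
            ((integrable_const _).indicator hK.compl) fun x => ?_
          by_cases hx : x ∈ K
          · simp [hx, hφK x hx]
          · simp only [Set.mem_compl_iff, hx, not_false_eq_true, Set.indicator_of_mem]
            linarith [hφg0 x, hgC x]
      _ = |C| * P.real Kᶜ := by
          rw [integral_indicator_const _ hK.compl, smul_eq_mul, mul_comm]
      _ ≤ |C| * δ := by gcongr
  have hN : ∫ x, φ x * g x ∂N ≤ |C| * δ := by
    calc ∫ x, φ x * g x ∂N ≤ ∫ x, U.indicator (fun _ => |C|) x ∂N := by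
          refine integral_mono (hφgi N) ((integrable_const _).indicator hU) fun x => ?_
          by_cases hx : x ∈ U
          · simpa [hx] using (hφgle x).trans (hgC x)
          · simp [hx, hφU x hx]
      _ = |C| * N.real U := by
          rw [integral_indicator_const _ hU, smul_eq_mul, mul_comm]
      _ ≤ |C| * δ := by gcongr
  have hlim := hvague (fun x => φ x * g x) (hφ.mul hg) hφc.mul_right
  have hlt : (∫ x, g x ∂P) - ε < (∫ x, φ x * g x ∂P) - ∫ x, φ x * g x ∂N := by linarith
  filter_upwards [hlim.eventually_const_lt hlt] with n hn
  have h1 : ∫ x, φ x * g x ∂Ps n ≤ ∫ x, g x ∂Ps n := integral_mono (hφgi _) (hgi _) hφgle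
  have h2 : 0 ≤ ∫ x, φ x * g x ∂Ns n := integral_nonneg hφg0
  linarith

/-- Asymptotic lower bounds on integrals of nonnegative bounded continuous functions, together
with an asymptotic upper bound on the total masses, imply weak convergence. -/
theorem tendsto_integral_of_eventually_sub_lt {Ω : Type*} [TopologicalSpace Ω]
    [TopologicalSpace.MetrizableSpace Ω] [MeasurableSpace Ω] [BorelSpace Ω]
    (Ps : ℕ → Measure Ω) (P : Measure Ω)
    [∀ n, IsFiniteMeasure (Ps n)] [IsFiniteMeasure P]
    (hlow : ∀ g : Ω → ℝ, Continuous g → (∀ x, 0 ≤ g x) → ∀ C : ℝ, (∀ x, g x ≤ C) →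
      ∀ ε : ℝ, 0 < ε → ∀ᶠ n in atTop, (∫ x, g x ∂P) - ε < ∫ x, g x ∂Ps n)
    (hmass : Tendsto (fun n => (Ps n).real Set.univ) atTop (𝓝 (P.real Set.univ)))
    {f : Ω → ℝ} (hf : Continuous f) {C : ℝ} (hC : ∀ x, |f x| ≤ C) :
    Tendsto (fun n => ∫ x, f x ∂Ps n) atTop (𝓝 (∫ x, f x ∂P)) := by
  have hadd : ∀ (Q : Measure Ω) [IsFiniteMeasure Q],
      ∫ x, (C + f x) ∂Q = C * Q.real Set.univ + ∫ x, f x ∂Q := fun Q _ => by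
    rw [integral_add (integrable_const _) (hf.integrable_of_abs_le hC Q), integral_const,
      smul_eq_mul, mul_comm]
  have hsub : ∀ (Q : Measure Ω) [IsFiniteMeasure Q],
      ∫ x, (C - f x) ∂Q = C * Q.real Set.univ - ∫ x, f x ∂Q := fun Q _ => by
    rw [integral_sub (integrable_const _) (hf.integrable_of_abs_le hC Q), integral_const,
      smul_eq_mul, mul_comm]
  have hCmass := hmass.const_mul C
  rw [Metric.tendsto_nhds] at hCmass ⊢
  intro ε hε
  filter_upwards [hCmass (ε / 2) (half_pos hε),
    hlow (fun x => C + f x) (by fun_prop) (fun x => by linarith [(abs_le.mp (hC x)).1]) (2 * C)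
      (fun x => by linarith [(abs_le.mp (hC x)).2]) (ε / 2) (half_pos hε),
    hlow (fun x => C - f x) (by fun_prop) (fun x => by linarith [(abs_le.mp (hC x)).2]) (2 * C)
      (fun x => by linarith [(abs_le.mp (hC x)).1]) (ε / 2) (half_pos hε)] with n h1 h2 h3
  rw [hadd, hadd] at h2
  rw [hsub, hsub] at h3
  rw [Real.dist_eq, abs_lt] at h1 ⊢
  constructor <;> linarith [h1.1, h1.2]

theorem tendsto_left_of_eventually_sub_lt {a b : ℕ → ℝ} {A B : ℝ}
    (ha : ∀ ε : ℝ, 0 < ε → ∀ᶠ n in atTop, A - ε < a n)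
    (hb : ∀ ε : ℝ, 0 < ε → ∀ᶠ n in atTop, B - ε < b n)
    (hab : ∀ ε : ℝ, 0 < ε → ∀ᶠ n in atTop, a n + b n < A + B + ε) :
    Tendsto a atTop (𝓝 A) := by
  rw [Metric.tendsto_nhds]
  intro ε hε
  filter_upwards [ha (ε / 2) (half_pos hε), hb (ε / 2) (half_pos hε),
    hab (ε / 2) (half_pos hε)] with n h1 h2 h3
  rw [Real.dist_eq, abs_lt]
  constructor <;> linarith

theorem stmt7 {Ω : Type*} [TopologicalSpace Ω] [TopologicalSpace.MetrizableSpace Ω] [LocallyCompactSpace Ω]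
    [MeasurableSpace Ω] [BorelSpace Ω]
    (μs : ℕ → SignedMeasure Ω) (μ : SignedMeasure Ω)
    (hRadonn : ∀ n, ((μs n).totalVariation).InnerRegular)
    (hRadon : (μ.totalVariation).InnerRegular)
    (hvague : VagueTendsto μs μ)
    (hmass : limsup (fun n => (μs n).totalVariation Set.univ) atTop
      ≤ μ.totalVariation Set.univ) :
    (∀ f : Ω → ℝ, Continuous f → (∃ C : ℝ, ∀ x, |f x| ≤ C) →
      Tendsto (fun n => ∫ x, f x ∂(μs n).toJordanDecomposition.posPart) atTop
        (𝓝 (∫ x, f x ∂μ.toJordanDecomposition.posPart))) ∧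
    (∀ f : Ω → ℝ, Continuous f → (∃ C : ℝ, ∀ x, |f x| ≤ C) →
      Tendsto (fun n => ∫ x, f x ∂(μs n).toJordanDecomposition.negPart) atTop
        (𝓝 (∫ x, f x ∂μ.toJordanDecomposition.negPart))) := by
  set P := μ.toJordanDecomposition.posPart
  set N := μ.toJordanDecomposition.negPart
  set Ps := fun n => (μs n).toJordanDecomposition.posPart with hPs
  set Ns := fun n => (μs n).toJordanDecomposition.negPart with hNs
  have hPsf : ∀ n, IsFiniteMeasure (Ps n) := fun n =>
    (μs n).toJordanDecomposition.posPart_finite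
  have hNsf : ∀ n, IsFiniteMeasure (Ns n) := fun n =>
    (μs n).toJordanDecomposition.negPart_finite
  have hsing : P ⟂ₘ N := μ.toJordanDecomposition.mutuallySingular
  have hreg : (P + N).InnerRegular := hRadon
  have hreg' : (N + P).InnerRegular := by rwa [add_comm]
  have hlowP : ∀ g : Ω → ℝ, Continuous g → (∀ x, 0 ≤ g x) → ∀ C : ℝ, (∀ x, g x ≤ C) →
      ∀ ε : ℝ, 0 < ε → ∀ᶠ n in atTop, (∫ x, g x ∂P) - ε < ∫ x, g x ∂Ps n :=
    fun g hg hg0 C hC ε hε =>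
      eventually_integral_sub_lt_of_vague Ps Ns P N hsing hreg hvague hg hg0 hC hε
  have hlowN : ∀ g : Ω → ℝ, Continuous g → (∀ x, 0 ≤ g x) → ∀ C : ℝ, (∀ x, g x ≤ C) →
      ∀ ε : ℝ, 0 < ε → ∀ᶠ n in atTop, (∫ x, g x ∂N) - ε < ∫ x, g x ∂Ns n :=
    fun g hg hg0 C hC ε hε =>
      eventually_integral_sub_lt_of_vague Ns Ps N P hsing.symm hreg'
        (fun f hf hfc => by simpa [sInt] using (hvague f hf hfc).neg) hg hg0 hC hε
  have hmP : ∀ ε : ℝ, 0 < ε →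
      ∀ᶠ n in atTop, P.real Set.univ - ε < (Ps n).real Set.univ := fun ε hε => by
    simpa using hlowP (fun _ => 1) continuous_const (fun _ => zero_le_one) 1 (fun _ => le_rfl) ε hε
  have hmN : ∀ ε : ℝ, 0 < ε →
      ∀ᶠ n in atTop, N.real Set.univ - ε < (Ns n).real Set.univ := fun ε hε => by
    simpa using hlowN (fun _ => 1) continuous_const (fun _ => zero_le_one) 1 (fun _ => le_rfl) ε hε
  have hsum : ∀ ε : ℝ, 0 < ε → ∀ᶠ n in atTop,
      (Ps n).real Set.univ + (Ns n).real Set.univ < P.real Set.univ + N.real Set.univ + ε := by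
    intro ε hε
    have hlt : (P + N) Set.univ < (P + N) Set.univ + ENNReal.ofReal ε :=
      ENNReal.lt_add_right (measure_ne_top _ _) (by simpa using hε)
    filter_upwards [eventually_lt_of_limsup_lt (hmass.trans_lt hlt)] with n hn
    have hn' : (Ps n + Ns n) Set.univ < (P + N) Set.univ + ENNReal.ofReal ε := hn
    have := ENNReal.toReal_strict_mono
      (ENNReal.add_ne_top.mpr ⟨measure_ne_top _ _, ENNReal.ofReal_ne_top⟩) hn'
    rw [ENNReal.toReal_add (measure_ne_top _ _) ENNReal.ofReal_ne_top,
      ENNReal.toReal_ofReal hε.le] at this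
    rwa [← measureReal_add_apply, ← measureReal_add_apply]
  have hsum' : ∀ ε : ℝ, 0 < ε → ∀ᶠ n in atTop,
      (Ns n).real Set.univ + (Ps n).real Set.univ < N.real Set.univ + P.real Set.univ + ε :=
    fun ε hε => (hsum ε hε).mono fun n hn => by linarith
  exact ⟨fun f hf ⟨C, hC⟩ => tendsto_integral_of_eventually_sub_lt Ps P hlowP
      (tendsto_left_of_eventually_sub_lt hmP hmN hsum) hf hC,
    fun f hf ⟨C, hC⟩ => tendsto_integral_of_eventually_sub_lt Ns N hlowN
      (tendsto_left_of_eventually_sub_lt hmN hmP hsum') hf hC⟩
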